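/- arXiv:1212.4349 — 4 statements merged into one kernel-verified Lean document; each statement's English description precedes it below -/
import Mathlib

section
/- The map sending an 𝔽-algebra automorphism φ of A to the Lie algebra automorphism of W given by 𝒟 ↦ φ ∘ 𝒟 ∘ φ⁻¹ is a group isomorphism from the group of 𝔽-algebra automorphisms of A onto the group of Lie algebra automorphisms of W. -/
open Polynomial

/-- The truncated polynomial algebra `A = 𝔽[x]/(xᵖ)`, realized as `𝔽[X] ⧸ (Xᵖ)`. -/
abbrev TruncA (F : Type*) [Field F] (p : ℕ) : Type _ :=
  AdjoinRoot (X ^ p : F[X])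

/-- The image `x` of the indeterminate in `A = 𝔽[x]/(xᵖ)`. -/
noncomputable def xA (F : Type*) [Field F] (p : ℕ) : TruncA F p :=
  AdjoinRoot.root _

/-- The Witt algebra `W₁ = Der_𝔽(A)`, the Lie algebra of `𝔽`-derivations of `A`. -/
abbrev Witt (F : Type*) [Field F] (p : ℕ) : Type _ :=
  Derivation F (TruncA F p) (TruncA F p)

/-! ### Commutators of multiples of a derivation -/

section Derivation

variable {R A : Type*} [CommRing R] [CommRing A] [Algebra R A]

theorem Derivation.lie_smul_smul_self (D : Derivation R A A) (a b : A) :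
    ⁅a • D, b • D⁆ = (a * D b - b * D a) • D := by
  ext c
  simp only [Derivation.commutator_apply, Derivation.smul_apply, smul_eq_mul, Derivation.leibniz]
  ring

theorem Derivation.lie_self_smul (D : Derivation R A A) (b : A) :
    ⁅D, b • D⁆ = D b • D := by
  ext c
  simp only [Derivation.commutator_apply, Derivation.smul_apply, smul_eq_mul, Derivation.leibniz]
  ring

theorem Derivation.lie_self_pow_smul (D : Derivation R A A) {y : A} (hy : D y = 1) (n : ℕ) :
    ⁅D, y ^ (n + 1) • D⁆ = (((n + 1 : ℕ) : A) * y ^ n) • D := by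
  rw [Derivation.lie_self_smul]
  simp [Derivation.leibniz_pow, hy]

theorem Derivation.lie_pow_smul_pow_smul (D : Derivation R A A) {y : A} (hy : D y = 1) (m n : ℕ) :
    ⁅y ^ (m + 1) • D, y ^ (n + 1) • D⁆ = (((n : A) - m) * y ^ (m + n + 1)) • D := by
  rw [Derivation.lie_smul_smul_self]
  congr 1
  simp only [Derivation.leibniz_pow, hy, nsmul_eq_mul, smul_eq_mul, Nat.add_sub_cancel]
  push_cast
  ring

theorem Derivation.iterate_lie_smul_smul_self (D : Derivation R A A) (a b : A) (k : ℕ) :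
    (fun Z => ⁅a • D, Z⁆)^[k] (b • D) = (fun w => a * D w - w * D a)^[k] b • D := by
  induction k with
  | zero => rfl
  | succ k ih => rw [Function.iterate_succ_apply', Function.iterate_succ_apply', ih,
      Derivation.lie_smul_smul_self]

/-- If `⁅E, y • E⁆ = E` and the multiple `v • E` behaves under `E` and `y • E` like
`yⁿ⁺¹ • E`, then `(n + 1) v = (n + 1) yⁿ⁺¹`. -/
theorem Derivation.natCast_mul_eq_of_lie_eq (E : Derivation R A A)
    (hE : Function.Injective fun a : A => a • E) {y v : A} {n : ℕ} (hy : E y = 1)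
    (h₁ : ⁅E, v • E⁆ = (((n + 1 : ℕ) : A) * y ^ n) • E)
    (h₂ : ⁅y • E, v • E⁆ = ((n : A) * v) • E) :
    ((n + 1 : ℕ) : A) * v = ((n + 1 : ℕ) : A) * y ^ (n + 1) := by
  have e₁ : E v = ((n + 1 : ℕ) : A) * y ^ n := hE ((E.lie_self_smul v).symm.trans h₁)
  have e₂ : y * E v - v * E y = (n : A) * v := hE ((E.lie_smul_smul_self y v).symm.trans h₂)
  rw [e₁, hy] at e₂
  push_cast at e₂ ⊢
  linear_combination -e₂

/-- Conjugation of derivations by an algebra automorphism, as a Lie algebra automorphism. -/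
def AlgEquiv.conjDerivation (φ : A ≃ₐ[R] A) : Derivation R A A ≃ₗ⁅R⁆ Derivation R A A where
  toFun E := Derivation.mk' (φ.toLinearMap ∘ₗ (E : A →ₗ[R] A) ∘ₗ φ.symm.toLinearMap)
    fun a b => by simp [Derivation.leibniz]
  invFun E := Derivation.mk' (φ.symm.toLinearMap ∘ₗ (E : A →ₗ[R] A) ∘ₗ φ.toLinearMap)
    fun a b => by simp [Derivation.leibniz]
  map_add' E E' := Derivation.ext fun a => map_add φ (E (φ.symm a)) (E' (φ.symm a))
  map_smul' r E := Derivation.ext fun a => map_smul φ r (E (φ.symm a))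
  map_lie' {E E'} := Derivation.ext fun a => by
    change φ (⁅E, E'⁆ (φ.symm a)) = φ (E (φ.symm (φ (E' (φ.symm a))))) -
      φ (E' (φ.symm (φ (E (φ.symm a)))))
    simp only [Derivation.commutator_apply, AlgEquiv.symm_apply_apply, map_sub]
  left_inv E := Derivation.ext fun a => by
    change φ.symm (φ (E (φ.symm (φ a)))) = E a
    simp only [AlgEquiv.symm_apply_apply]
  right_inv E := Derivation.ext fun a => by
    change φ (φ.symm (E (φ (φ.symm a)))) = E a
    simp only [AlgEquiv.apply_symm_apply]

@[simp]
theorem AlgEquiv.conjDerivation_apply (φ : A ≃ₐ[R] A) (E : Derivation R A A) (a : A) :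
    φ.conjDerivation E a = φ (E (φ.symm a)) := rfl

theorem LieEquiv.iterate_lie_map {L : Type*} [LieRing L] [LieAlgebra R L] (θ : L ≃ₗ⁅R⁆ L)
    (Y Z : L) (k : ℕ) : (fun Z => ⁅θ Y, Z⁆)^[k] (θ Z) = θ ((fun Z => ⁅Y, Z⁆)^[k] Z) := by
  induction k with
  | zero => rfl
  | succ k ih =>
    rw [Function.iterate_succ_apply', Function.iterate_succ_apply', ih, LieEquiv.map_lie]

end Derivation

namespace TruncA

variable {F : Type*} [Field F] {p : ℕ}

/-! ### The truncated polynomial algebra -/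

@[simp]
theorem xA_pow : xA F p ^ p = 0 := by
  have := AdjoinRoot.eval₂_root (X ^ p : F[X])
  simpa [xA] using this

theorem mk_eq_aeval (f : F[X]) : AdjoinRoot.mk (X ^ p) f = aeval (xA F p) f :=
  (AdjoinRoot.aeval_eq f).symm

theorem derivation_ext {E E' : Witt F p} (h : E (xA F p) = E' (xA F p)) : E = E' :=
  Derivation.ext_of_adjoin_eq_top _ (AdjoinRoot.adjoinRoot_eq_top (f := (X ^ p : F[X])))
    (by simpa [Set.eqOn_singleton, xA] using h)

theorem linearMap_ext {M : Type*} [AddCommGroup M] [Module F M] {f g : TruncA F p →ₗ[F] M}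
    (h : ∀ n, f (xA F p ^ n) = g (xA F p ^ n)) : f = g := by
  ext a
  induction a using AdjoinRoot.induction_on with
  | ih q =>
    rw [mk_eq_aeval, aeval_eq_sum_range]
    simp [h]

theorem isUnit_natCast [CharP F p] {n : ℕ} (hn : ¬ p ∣ n) : IsUnit (n : TruncA F p) := by
  have : (n : F) ≠ 0 := by rwa [Ne, CharP.cast_eq_zero_iff F p]
  simpa only [map_natCast] using (IsUnit.mk0 _ this).map (algebraMap F (TruncA F p))

theorem natCast_prime_eq_zero [CharP F p] : (p : TruncA F p) = 0 := by
  rw [← map_natCast (algebraMap F (TruncA F p)), CharP.cast_eq_zero, map_zero]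

/-- The augmentation `A → 𝔽` sending `x` to `0`. -/
noncomputable def augmentation (F : Type*) [Field F] (p : ℕ) [NeZero p] : TruncA F p →ₐ[F] F :=
  AdjoinRoot.liftAlgHom _ (Algebra.ofId F F) 0 (by simp [NeZero.ne p])

section

variable [NeZero p]

@[simp]
theorem augmentation_xA : augmentation F p (xA F p) = 0 :=
  AdjoinRoot.liftAlgHom_root ..

theorem xA_dvd_of_augmentation_eq_zero {a : TruncA F p} (ha : augmentation F p a = 0) :
    xA F p ∣ a := by
  induction a using AdjoinRoot.induction_on with
  | ih q =>
    have h : q.coeff 0 = 0 := by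
      simpa [augmentation, eval₂_at_zero] using ha
    obtain ⟨r, rfl⟩ := X_dvd_iff.2 h
    exact ⟨AdjoinRoot.mk _ r, by simp [xA]⟩

theorem isUnit_of_augmentation_ne_zero {a : TruncA F p} (ha : augmentation F p a ≠ 0) :
    IsUnit a := by
  set c := augmentation F p a
  obtain ⟨b, hb⟩ := xA_dvd_of_augmentation_eq_zero (a := a - algebraMap F _ c) (by
    rw [map_sub, AlgHom.commutes, Algebra.algebraMap_self, RingHom.id_apply, sub_self])
  have hnil : IsNilpotent (xA F p * b) := ⟨p, by simp [mul_pow]⟩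
  have hc : IsUnit (algebraMap F (TruncA F p) c) := (IsUnit.mk0 c ha).map _
  have : a = xA F p * b + algebraMap F _ c := by rw [← hb]; ring
  rw [this]
  exact hnil.isUnit_add_right_of_commute hc (Commute.all _ _)

instance : Nontrivial (TruncA F p) := (augmentation F p).toRingHom.domain_nontrivial

end

/-! ### The derivation `D = d/dx` -/

variable [CharP F p]

theorem mk_derivative_eq_zero (q : F[X]) (hq : AdjoinRoot.mkₐ (X ^ p : F[X]) q = 0) :
    AdjoinRoot.mkₐ (X ^ p : F[X]) (derivative' q) = 0 := by
  obtain ⟨r, rfl⟩ := AdjoinRoot.mk_eq_zero.1 hq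
  refine AdjoinRoot.mk_eq_zero.2 ⟨derivative r, ?_⟩
  simp [derivative']

/-- The derivation `D` of `A` with `D x = 1`. -/
noncomputable def dx (F : Type*) [Field F] (p : ℕ) [CharP F p] : Witt F p :=
  Derivation.liftOfSurjective (f := AdjoinRoot.mkₐ (X ^ p : F[X])) AdjoinRoot.mk_surjective
    mk_derivative_eq_zero

theorem dx_mk (q : F[X]) :
    dx F p (AdjoinRoot.mk (X ^ p) q) = AdjoinRoot.mk (X ^ p) (derivative q) :=
  Derivation.liftOfSurjective_apply (f := AdjoinRoot.mkₐ (X ^ p : F[X]))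
    AdjoinRoot.mk_surjective mk_derivative_eq_zero q

theorem dx_iterate_mk (q : F[X]) (k : ℕ) :
    (dx F p)^[k] (AdjoinRoot.mk (X ^ p) q) = AdjoinRoot.mk (X ^ p) (derivative^[k] q) := by
  induction k with
  | zero => rfl
  | succ k ih => rw [Function.iterate_succ_apply', Function.iterate_succ_apply', ih, dx_mk]

@[simp]
theorem dx_xA : dx F p (xA F p) = 1 := by
  have := dx_mk (p := p) (X : F[X])
  simpa [xA] using this

theorem eq_smul_dx (E : Witt F p) : E = E (xA F p) • dx F p :=
  derivation_ext (by simp)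

theorem smul_dx_injective : Function.Injective fun a : TruncA F p => a • dx F p := fun a b h => by
  simpa using congr($h (xA F p))

theorem lie_coeff_formula (b v : TruncA F p) (k : ℕ) :
    xA F p ^ 2 * b * dx F p (xA F p ^ k * v) - xA F p ^ k * v * dx F p (xA F p ^ 2 * b) =
      xA F p ^ (k + 1) *
        (((k : TruncA F p) - 2) * b * v + xA F p * (b * dx F p v - v * dx F p b)) := by
  cases k with
  | zero => simp [Derivation.leibniz, Derivation.leibniz_pow]; ring
  | succ k => simp [Derivation.leibniz, Derivation.leibniz_pow]; ring

theorem conjDerivation_injective :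
    Function.Injective (AlgEquiv.conjDerivation (R := F) (A := TruncA F p)) := by
  intro φ ψ h
  have key : ∀ E : Witt F p, φ (E (xA F p)) = ψ (E (ψ.symm (φ (xA F p)))) := fun E => by
    simpa using congr($h E (φ (xA F p)))
  have h₁ : dx F p (ψ.symm (φ (xA F p))) = 1 := by
    refine ψ.injective ?_
    simpa [eq_comm] using key (dx F p)
  have h₂ := key (xA F p • dx F p)
  refine AlgEquiv.coe_toAlgHom_injective (AdjoinRoot.algHom_ext ?_)
  change φ (xA F p) = ψ (xA F p)
  simpa [h₁] using h₂

variable [Fact p.Prime]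

theorem dx_iterate_prime (a : TruncA F p) : (dx F p)^[p] a = 0 := by
  induction a using AdjoinRoot.induction_on with
  | ih q =>
    have h : ((p.factorial : ℕ) : F) = 0 :=
      (CharP.cast_eq_zero_iff F p _).2 ((Fact.out : p.Prime).dvd_factorial.2 le_rfl)
    rw [dx_iterate_mk, ← factorial_smul_hasseDeriv, LinearMap.smul_apply,
      ← Nat.cast_smul_eq_nsmul F, h, zero_smul, map_zero]

theorem isUnit_factorial_pred : IsUnit ((p - 1).factorial : TruncA F p) := by
  have hp : p.Prime := Fact.out
  refine isUnit_natCast ?_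
  rw [hp.dvd_factorial]
  have := hp.pos
  omega

theorem dx_iterate_pred_xA_pow_ne_zero : (dx F p)^[p - 1] (xA F p ^ (p - 1)) ≠ 0 := by
  have : xA F p ^ (p - 1) = AdjoinRoot.mk (X ^ p) (X ^ (p - 1)) := by simp [xA]
  rw [this, dx_iterate_mk, iterate_derivative_X_pow_eq_C_mul]
  simpa [Nat.descFactorial_self] using (isUnit_factorial_pred (F := F) (p := p)).ne_zero

/-! ### Derivations vanishing at the origin -/

/-- If `e • D` vanishes at the origin and `(ad (e • D))ᵖ D = 0`, then `e` vanishes to second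
order. -/
theorem augmentation_dx_eq_zero {e : TruncA F p} (he : augmentation F p e = 0)
    (h : (fun w => e * dx F p w - w * dx F p e)^[p] 1 = 0) :
    augmentation F p (dx F p e) = 0 := by
  have key : ∀ k, augmentation F p ((fun w => e * dx F p w - w * dx F p e)^[k] 1) =
      (-augmentation F p (dx F p e)) ^ k := by
    intro k
    induction k with
    | zero => simp
    | succ k ih => rw [Function.iterate_succ_apply', map_sub, map_mul, map_mul, ih, he]; ring
  have := key p
  rw [h, map_zero] at this
  exact neg_eq_zero.1 (eq_zero_of_pow_eq_zero this.symm)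

/-- If `e` vanishes to second order at the origin, then `(ad (e • D))ᵖ⁻¹ = 0`. -/
theorem iterate_eq_zero_of_augmentation_eq_zero (hp : 3 < p) {e : TruncA F p}
    (he : augmentation F p e = 0) (he' : augmentation F p (dx F p e) = 0) (w : TruncA F p) :
    (fun w => e * dx F p w - w * dx F p e)^[p - 1] w = 0 := by
  obtain ⟨b, rfl⟩ := xA_dvd_of_augmentation_eq_zero he
  obtain ⟨b, rfl⟩ := xA_dvd_of_augmentation_eq_zero (a := b) (by
    simpa [Derivation.leibniz] using he')
  set T : TruncA F p → TruncA F p := fun w => xA F p * (xA F p * b) * dx F p w -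
    w * dx F p (xA F p * (xA F p * b)) with hT
  have hT' : ∀ (k : ℕ) (v : TruncA F p), T (xA F p ^ k * v) = xA F p ^ (k + 1) *
      (((k : TruncA F p) - 2) * b * v + xA F p * (b * dx F p v - v * dx F p b)) := by
    intro k v
    rw [← lie_coeff_formula, hT, pow_two, mul_assoc (xA F p)]
  have hsucc : ∀ k v, xA F p ^ k ∣ v → xA F p ^ (k + 1) ∣ T v := by
    rintro k _ ⟨v, rfl⟩
    exact ⟨_, hT' k v⟩
  have htwo : ∀ v, xA F p ^ 2 ∣ v → xA F p ^ 4 ∣ T v := by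
    rintro _ ⟨v, rfl⟩
    refine ⟨b * dx F p v - v * dx F p b, ?_⟩
    rw [hT']
    push_cast
    ring
  have hthree : xA F p ^ 4 ∣ T^[3] w :=
    htwo _ (hsucc 1 _ (hsucc 0 _ (by simp)))
  have key : ∀ k, xA F p ^ (k + 4) ∣ T^[k + 3] w := by
    intro k
    induction k with
    | zero => exact hthree
    | succ k ih =>
      rw [show k + 1 + 3 = (k + 3) + 1 by ring, Function.iterate_succ_apply']
      exact hsucc _ _ ih
  have := key (p - 4)
  rw [show p - 4 + 4 = p by omega, show p - 4 + 3 = p - 1 by omega, xA_pow] at this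
  exact zero_dvd_iff.1 this

/-! ### Lie automorphisms come from algebra automorphisms -/

/-- The image of `D` under a Lie automorphism does not vanish at the origin. -/
theorem isUnit_lieEquiv_dx (hp : 3 < p) (θ : Witt F p ≃ₗ⁅F⁆ Witt F p) :
    IsUnit (θ (dx F p) (xA F p)) := by
  set e := θ (dx F p) (xA F p)
  have hE : θ (dx F p) = e • dx F p := eq_smul_dx _
  have hD : ∀ (k : ℕ) (a : TruncA F p),
      (fun Z => ⁅dx F p, Z⁆)^[k] (a • dx F p) = (dx F p)^[k] a • dx F p := by
    intro k a
    simpa using (dx F p).iterate_lie_smul_smul_self 1 a k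
  have key : ∀ (k : ℕ) (Z : Witt F p),
      (fun w => e * dx F p w - w * dx F p e)^[k] (θ Z (xA F p)) • dx F p =
        θ ((dx F p)^[k] (Z (xA F p)) • dx F p) := by
    intro k Z
    rw [← Derivation.iterate_lie_smul_smul_self, ← hE, ← eq_smul_dx, LieEquiv.iterate_lie_map, ← hD,
      ← eq_smul_dx]
  by_contra hu
  have h₀ : augmentation F p e = 0 := by
    by_contra h
    exact hu (isUnit_of_augmentation_ne_zero h)
  have h₁ : augmentation F p (dx F p e) = 0 := by
    refine augmentation_dx_eq_zero h₀ (smul_dx_injective ?_)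
    simpa [dx_iterate_prime] using key p (θ.symm (dx F p))
  have h₂ := key (p - 1) (xA F p ^ (p - 1) • dx F p)
  rw [iterate_eq_zero_of_augmentation_eq_zero hp h₀ h₁, zero_smul, ← map_zero θ] at h₂
  have h₃ := congr($(θ.injective h₂) (xA F p))
  exact dx_iterate_pred_xA_pow_ne_zero (F := F) (p := p) (by simpa using h₃.symm)

/-- A Lie automorphism `θ` maps `xⁿ • D` to `yⁿ • θ D` for some `y` with `(θ D) y = 1` and
`yᵖ = 0`. -/
theorem exists_lieEquiv_xA_pow_smul_dx (hp : 3 < p) (θ : Witt F p ≃ₗ⁅F⁆ Witt F p) :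
    ∃ y : TruncA F p, θ (dx F p) y = 1 ∧ y ^ p = 0 ∧
      ∀ n, θ (xA F p ^ n • dx F p) = y ^ n • θ (dx F p) := by
  set E := θ (dx F p) with hE
  obtain ⟨u, hu⟩ := isUnit_lieEquiv_dx hp θ
  have hinj : Function.Injective fun a : TruncA F p => a • E := fun a b h => by
    have := congr($h (xA F p))
    simpa [hE, ← hu] using this
  have hsurj : ∀ Z : Witt F p, ∃ v : TruncA F p, Z = v • E := fun Z =>
    ⟨Z (xA F p) * ↑u⁻¹, derivation_ext (by simp [hE, ← hu])⟩
  obtain ⟨y, hy⟩ := hsurj (θ (xA F p • dx F p))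
  have hEy : E y = 1 := by
    refine hinj ?_
    simp only
    rw [← Derivation.lie_self_smul, ← hy, hE, ← LieEquiv.map_lie, Derivation.lie_self_smul]
    simp
  have hlt : ∀ n < p, θ (xA F p ^ n • dx F p) = y ^ n • E := by
    intro n
    induction n with
    | zero => intro _; simp [hE]
    | succ n ih =>
      intro hn
      obtain ⟨v, hv⟩ := hsurj (θ (xA F p ^ (n + 1) • dx F p))
      have hn0 : IsUnit ((n + 1 : ℕ) : TruncA F p) :=
        isUnit_natCast fun h => absurd (Nat.le_of_dvd n.succ_pos h) (by omega)
      have h₁ : ⁅E, v • E⁆ = (((n + 1 : ℕ) : TruncA F p) * y ^ n) • E := by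
        rw [mul_smul, Nat.cast_smul_eq_nsmul, ← ih (by omega), ← hv, hE, ← LieEquiv.map_lie,
          Derivation.lie_self_pow_smul _ dx_xA, ← map_nsmul, mul_smul, Nat.cast_smul_eq_nsmul]
      have h₂ : ⁅y • E, v • E⁆ = ((n : TruncA F p) * v) • E := by
        have := (dx F p).lie_pow_smul_pow_smul dx_xA 0 n
        rw [zero_add, pow_one, zero_add, Nat.cast_zero, sub_zero, mul_smul,
          Nat.cast_smul_eq_nsmul] at this
        rw [mul_smul, Nat.cast_smul_eq_nsmul, ← hv, ← hy, ← LieEquiv.map_lie, this, map_nsmul]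
      have h₃ := E.natCast_mul_eq_of_lie_eq hinj hEy h₁ h₂
      rw [hv, hn0.mul_left_cancel h₃]
  have hyp : y ^ p = 0 := by
    obtain ⟨n, rfl⟩ : ∃ n, p = n + 2 := ⟨p - 2, by omega⟩
    have h : (((n : TruncA F (n + 2)) - 1) * y ^ (n + 2)) • E = 0 := by
      have hE' := E.lie_pow_smul_pow_smul hEy 1 n
      have hD := (dx F (n + 2)).lie_pow_smul_pow_smul dx_xA 1 n
      rw [show 1 + n + 1 = n + 2 by ring, Nat.cast_one] at hE' hD
      rw [← hE', ← hlt 2 (by omega), ← hlt (n + 1) (by omega), ← LieEquiv.map_lie, hD, xA_pow,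
        mul_zero, zero_smul, map_zero]
    have h₀ : ((n : TruncA F (n + 2)) - 1) * y ^ (n + 2) = 0 := hinj (h.trans (zero_smul _ E).symm)
    have h₃ : IsUnit ((3 : ℕ) : TruncA F (n + 2)) :=
      isUnit_natCast fun h => absurd (Nat.le_of_dvd three_pos h) (by omega)
    have hc : ((n + 2 : ℕ) : TruncA F (n + 2)) = 0 := natCast_prime_eq_zero
    refine (h₃.mul_right_eq_zero).1 ?_
    push_cast at hc ⊢
    linear_combination y ^ (n + 2) * hc - h₀
  refine ⟨y, hEy, hyp, fun n => ?_⟩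
  rcases lt_or_ge n p with hn | hn
  · exact hlt n hn
  · rw [pow_eq_zero_of_le hn hyp, pow_eq_zero_of_le hn xA_pow]
    simp

theorem conjDerivation_surjective (hp : 3 < p) :
    Function.Surjective (AlgEquiv.conjDerivation (R := F) (A := TruncA F p)) := by
  intro θ
  obtain ⟨y, hy, hyp, hθ⟩ := exists_lieEquiv_xA_pow_smul_dx hp θ
  obtain ⟨u, hu⟩ := isUnit_lieEquiv_dx hp θ
  let φ : TruncA F p →ₐ[F] TruncA F p :=
    AdjoinRoot.liftAlgHom _ (Algebra.ofId F _) y (by simpa using hyp)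
  have hφx : φ (xA F p) = y := AdjoinRoot.liftAlgHom_root ..
  have hφ : ∀ a, θ (a • dx F p) = φ a • θ (dx F p) := by
    have := linearMap_ext (f := (θ : Witt F p →ₗ[F] Witt F p) ∘ₗ
        (LinearMap.toSpanSingleton (TruncA F p) (Witt F p) (dx F p)).restrictScalars F)
      (g := (LinearMap.toSpanSingleton (TruncA F p) (Witt F p) (θ (dx F p))).restrictScalars F ∘ₗ
        φ.toLinearMap) (fun n => by simpa [hφx] using hθ n)
    exact fun a => congr($this a)
  have hbij : Function.Bijective φ := by
    constructor
    · refine (injective_iff_map_eq_zero φ).2 fun a ha => smul_dx_injective (θ.injective ?_)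
      simp [hφ, ha]
    · intro b
      have h := hφ (θ.symm (b • θ (dx F p)) (xA F p))
      rw [← eq_smul_dx, LieEquiv.apply_symm_apply] at h
      have := congr($h (xA F p))
      exact ⟨_, by simpa [← hu] using this.symm⟩
  refine ⟨AlgEquiv.ofBijective φ hbij, ?_⟩
  ext Z : 1
  set ψ := AlgEquiv.ofBijective φ hbij
  have hψ : ∀ a, ψ a = φ a := fun _ => rfl
  suffices Z = ψ.conjDerivation.symm (θ Z) by rw [this, LieEquiv.apply_symm_apply, ← this]
  refine derivation_ext (ψ.injective ?_)
  have h₁ : ψ (ψ.conjDerivation.symm (θ Z) (xA F p)) = θ Z y := by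
    rw [← hφx, ← hψ]
    exact ψ.apply_symm_apply _
  rw [h₁, eq_smul_dx Z, hφ]
  simp [hy, hψ]

end TruncA

/-- The map sending an algebra automorphism `φ` of `A` to the Lie algebra automorphism
`𝒟 ↦ φ ∘ 𝒟 ∘ φ⁻¹` of `W = Der_𝔽(A)` is a group isomorphism from `Aut_𝔽-alg(A)` onto
`Aut_Lie(W)`: it is bijective, respects composition, and acts by conjugation. -/
theorem algebra_aut_equiv_lie_aut
    (F : Type*) [Field F] [IsAlgClosed F] (p : ℕ) [Fact p.Prime] [CharP F p] (hp : 3 < p) :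
    ∃ e : (TruncA F p ≃ₐ[F] TruncA F p) → (Witt F p ≃ₗ⁅F⁆ Witt F p),
      Function.Bijective e ∧
      (∀ φ ψ : TruncA F p ≃ₐ[F] TruncA F p, e (φ.trans ψ) = (e φ).trans (e ψ)) ∧
      (∀ (φ : TruncA F p ≃ₐ[F] TruncA F p) (E : Witt F p) (a : TruncA F p),
        (e φ) E a = φ (E (φ.symm a))) := by
  exact ⟨AlgEquiv.conjDerivation,
    ⟨TruncA.conjDerivation_injective, TruncA.conjDerivation_surjective hp⟩,
    fun _ _ => rfl, fun _ _ _ => rfl⟩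
end

section
/- Let X ∈ W with Xᵖ = 0 (powers as composition of linear endomorphisms of A). Then X does not lie in the span of {xD, x²D, …, x^{p−1}D} if and only if there exists a Lie algebra automorphism σ of W with σ(D) = X. -/
open Polynomial

namespace Derivation

variable {R A : Type*} [CommRing R] [CommRing A] [Algebra R A]

/-- The conjugate of a derivation by an algebra automorphism. -/
def conj (e : A ≃ₐ[R] A) (Z : Derivation R A A) : Derivation R A A :=
  mk' (e.toLinearMap ∘ₗ Z.toLinearMap ∘ₗ e.symm.toLinearMap) fun a b => by simp

@[simp]
theorem conj_apply (e : A ≃ₐ[R] A) (Z : Derivation R A A) (a : A) :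
    conj e Z a = e (Z (e.symm a)) :=
  rfl

/-- Conjugation by an algebra automorphism, as a Lie algebra automorphism of the derivations. -/
def conjLieEquiv (e : A ≃ₐ[R] A) : Derivation R A A ≃ₗ⁅R⁆ Derivation R A A where
  toFun := conj e
  map_add' Z₁ Z₂ := by ext a; simp
  map_smul' r Z := by ext a; simp
  map_lie' {Z₁ Z₂} := by ext a; simp [commutator_apply, -commutator_coe_linear_map]
  invFun := conj e.symm
  left_inv Z := by ext a; simp
  right_inv Z := by ext a; simp

theorem conjLieEquiv_apply (e : A ≃ₐ[R] A) (Z : Derivation R A A) (a : A) :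
    conjLieEquiv e Z a = e (Z (e.symm a)) :=
  rfl

end Derivation

section TruncatedPolynomial

variable {F : Type*} [Field F] {p : ℕ}

theorem xA_pow_eq_zero {n : ℕ} (h : p ≤ n) : xA F p ^ n = 0 := by
  refine pow_eq_zero_of_le h ?_
  rw [xA, ← AdjoinRoot.mk_X, ← map_pow, AdjoinRoot.mk_self]

theorem xA_pow_ne_zero {n : ℕ} (h : n < p) : xA F p ^ n ≠ 0 := by
  rw [xA, ← AdjoinRoot.mk_X, ← map_pow]
  exact AdjoinRoot.mk_ne_zero_of_natDegree_lt (monic_X_pow p) (pow_ne_zero _ X_ne_zero)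
    (by simpa using h)

theorem exists_mk_eq_of_degree_lt (a : TruncA F p) :
    ∃ q : F[X], q.degree < p ∧ AdjoinRoot.mk (X ^ p) q = a := by
  obtain ⟨q, rfl⟩ := AdjoinRoot.mk_surjective a
  refine ⟨q %ₘ X ^ p, ?_, ?_⟩
  · simpa using degree_modByMonic_lt q (monic_X_pow (R := F) p)
  · rw [AdjoinRoot.mk_eq_mk, modByMonic_eq_sub_mul_div q (X ^ p)]
    exact ⟨-(q /ₘ X ^ p), by ring⟩

theorem witt_ext {Y Z : Witt F p} (h : Y (xA F p) = Z (xA F p)) : Y = Z :=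
  Derivation.ext_of_adjoin_eq_top {xA F p} AdjoinRoot.adjoinRoot_eq_top (by simpa using h)

theorem witt_apply_mk {D : Witt F p} (hD : D (xA F p) = 1) (q : F[X]) :
    D (AdjoinRoot.mk _ q) = AdjoinRoot.mk _ (derivative q) := by
  rw [← AdjoinRoot.aeval_eq, ← AdjoinRoot.aeval_eq]
  have h := D.map_aeval q (xA F p)
  rw [hD, smul_eq_mul, mul_one] at h
  exact h

theorem witt_eq_smul {D : Witt F p} (hD : D (xA F p) = 1) (Y : Witt F p) :
    Y = Y (xA F p) • D :=
  witt_ext (by simp [hD])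

theorem xA_mul_smul_mem_span (D : Witt F p) (a : TruncA F p) :
    (xA F p * a) • D ∈
      Submodule.span F ((fun i : ℕ => xA F p ^ i • D) '' Set.Icc 1 (p - 1)) := by
  induction a using AdjoinRoot.induction_on with
  | ih q =>
    induction q using Polynomial.induction_on' with
    | add q r hq hr =>
      rw [map_add, mul_add, add_smul]
      exact add_mem hq hr
    | monomial n c =>
      have h : xA F p * AdjoinRoot.mk _ (monomial n c) = c • xA F p ^ (n + 1) := by
        rw [← C_mul_X_pow_eq_monomial, map_mul, map_pow, AdjoinRoot.mk_X, AdjoinRoot.mk_C,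
          Algebra.smul_def, AdjoinRoot.algebraMap_eq, xA]
        ring
      rw [h, smul_assoc]
      refine Submodule.smul_mem _ _ ?_
      by_cases hn : n + 1 ≤ p - 1
      · exact Submodule.subset_span ⟨n + 1, ⟨by omega, hn⟩, rfl⟩
      · rw [xA_pow_eq_zero (by omega), zero_smul]
        exact zero_mem _

theorem eq_C_of_derivative_eq_zero_of_degree_lt [CharP F p] {q : F[X]} (hq : q.degree < p)
    (h : derivative q = 0) : q = C (q.coeff 0) := by
  ext n
  rw [coeff_C]
  split_ifs with hn
  · rw [hn]
  · obtain ⟨m, rfl⟩ := Nat.exists_eq_succ_of_ne_zero hn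
    by_cases hm : m + 1 < p
    · have h1 := coeff_derivative q m
      rw [h, coeff_zero] at h1
      refine (mul_eq_zero.mp h1.symm).resolve_right fun h2 => ?_
      have h3 : ((m + 1 : ℕ) : F) = 0 := by exact_mod_cast h2
      exact Nat.not_dvd_of_pos_of_lt (by omega) hm ((CharP.cast_eq_zero_iff F p _).mp h3)
    · exact coeff_eq_zero_of_degree_lt (hq.trans_le (by exact_mod_cast not_lt.mp hm))

theorem exists_algebraMap_eq_of_apply_eq_zero [CharP F p] {D : Witt F p} (hD : D (xA F p) = 1)
    {a : TruncA F p} (h : D a = 0) : ∃ c : F, algebraMap F _ c = a := by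
  obtain ⟨q, hq, rfl⟩ := exists_mk_eq_of_degree_lt a
  refine ⟨q.coeff 0, ?_⟩
  have h0 : derivative q = 0 := by
    by_contra hne
    refine AdjoinRoot.mk_ne_zero_of_degree_lt (monic_X_pow p) hne ?_
      ((witt_apply_mk hD q).symm.trans h)
    rw [degree_X_pow]
    exact (degree_derivative_le).trans_lt hq
  conv_rhs => rw [eq_C_of_derivative_eq_zero_of_degree_lt hq h0]
  rw [AdjoinRoot.mk_C, AdjoinRoot.algebraMap_eq]

theorem apply_algHom_eq {D Y : Witt F p} (hD : D (xA F p) = 1)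
    (φ : TruncA F p →ₐ[F] TruncA F p) (h : Y (φ (xA F p)) = 1) (a : TruncA F p) :
    Y (φ a) = φ (D a) := by
  obtain ⟨q, rfl⟩ := AdjoinRoot.mk_surjective a
  rw [witt_apply_mk hD, ← AdjoinRoot.aeval_eq, ← AdjoinRoot.aeval_eq, ← aeval_algHom_apply φ,
    ← aeval_algHom_apply φ, Derivation.map_aeval]
  change _ • Y (φ (xA F p)) = _
  rw [h, smul_eq_mul, mul_one]

theorem exists_eq_smul_of_lie_eq_zero [CharP F p] {D Y Z : Witt F p} (hD : D (xA F p) = 1)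
    (σ : Witt F p ≃ₗ⁅F⁆ Witt F p) (hσ : σ D = Y) (h : ⁅Y, Z⁆ = 0) : ∃ c : F, Z = c • Y := by
  have h1 : ⁅D, σ.symm Z⁆ = 0 := by
    apply σ.injective
    change σ _ = σ _
    rw [LieEquiv.map_lie, hσ, LieEquiv.apply_symm_apply, h, map_zero]
  have h2 : D ((σ.symm Z) (xA F p)) = 0 := by
    have := congrArg (fun T : Witt F p => T (xA F p)) h1
    simpa [Derivation.commutator_apply, hD] using this
  obtain ⟨c, hc⟩ := exists_algebraMap_eq_of_apply_eq_zero hD h2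
  refine ⟨c, ?_⟩
  have h3 : σ.symm Z = c • D := by
    rw [witt_eq_smul hD (σ.symm Z), ← hc, algebraMap_smul]
  rw [← σ.apply_symm_apply Z, h3, map_smul, hσ]

/-- Evaluation of a truncated polynomial at the origin. -/
noncomputable def truncEval (F : Type*) [Field F] (p : ℕ) [Fact p.Prime] : TruncA F p →ₐ[F] F :=
  AdjoinRoot.liftAlgHom _ (AlgHom.id F F) 0 (by simp [(Fact.out : p.Prime).ne_zero])

variable [Fact p.Prime]

@[simp]
theorem truncEval_xA : truncEval F p (xA F p) = 0 :=
  AdjoinRoot.liftAlgHom_root _ _ _ _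

theorem truncEval_sub_algebraMap (a : TruncA F p) :
    truncEval F p (a - algebraMap F _ (truncEval F p a)) = 0 := by
  rw [map_sub, AlgHom.commutes, Algebra.algebraMap_self_apply, sub_self]

theorem exists_eq_algebraMap_add_xA_mul (a : TruncA F p) :
    ∃ b, a = algebraMap F _ (truncEval F p a) + xA F p * b := by
  obtain ⟨q, rfl⟩ := AdjoinRoot.mk_surjective a
  have h : truncEval F p (AdjoinRoot.mk _ q) = q.coeff 0 := by
    simp [truncEval, coeff_zero_eq_eval_zero, eval₂_eq_eval_map]
  refine ⟨AdjoinRoot.mk _ q.divX, ?_⟩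
  rw [h]
  conv_lhs => rw [← q.divX_mul_X_add]
  rw [map_add, map_mul, AdjoinRoot.mk_X, AdjoinRoot.mk_C, AdjoinRoot.algebraMap_eq, xA]
  ring

theorem exists_eq_xA_mul {a : TruncA F p} (h : truncEval F p a = 0) : ∃ b, a = xA F p * b := by
  obtain ⟨b, hb⟩ := exists_eq_algebraMap_add_xA_mul a
  exact ⟨b, by rw [hb, h]; simp⟩

theorem pow_eq_zero_of_truncEval_eq_zero {a : TruncA F p} (h : truncEval F p a = 0) :
    a ^ p = 0 := by
  obtain ⟨b, rfl⟩ := exists_eq_xA_mul h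
  rw [mul_pow, xA_pow_eq_zero le_rfl, zero_mul]

theorem truncEval_eq_zero_of_xA_mul_eq_zero {a : TruncA F p}
    (h : xA F p * a = 0) : truncEval F p a = 0 := by
  have hp := (Fact.out : p.Prime).two_le
  obtain ⟨b, hb⟩ := exists_eq_algebraMap_add_xA_mul a
  by_contra hne
  refine xA_pow_ne_zero (F := F) (p := p) (n := p - 1) (by omega) ?_
  have h1 : xA F p ^ (p - 1) * a = 0 := by
    rw [show p - 1 = p - 2 + 1 by omega, pow_succ, mul_assoc, h, mul_zero]
  rw [hb, mul_add, ← mul_assoc, ← pow_succ, xA_pow_eq_zero (n := p - 1 + 1) (by omega), zero_mul, add_zero,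
    mul_comm, ← Algebra.smul_def] at h1
  exact (smul_eq_zero.mp h1).resolve_left hne

theorem mem_span_xA_pow_smul_iff {D : Witt F p} (hD : D (xA F p) = 1) (Y : Witt F p) :
    Y ∈ Submodule.span F ((fun i : ℕ => xA F p ^ i • D) '' Set.Icc 1 (p - 1)) ↔
      truncEval F p (Y (xA F p)) = 0 := by
  constructor
  · intro h
    induction h using Submodule.span_induction with
    | mem Z hZ =>
      obtain ⟨i, hi, rfl⟩ := hZ
      have : i ≠ 0 := by have := hi.1; omega
      simp [hD, this]
    | zero => simp
    | add Z₁ Z₂ _ _ h₁ h₂ => simp [h₁, h₂]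
    | smul c Z _ h => simp [h]
  · intro h
    obtain ⟨b, hb⟩ := exists_eq_xA_mul h
    rw [witt_eq_smul hD Y, hb]
    exact xA_mul_smul_mem_span D b

theorem truncEval_iterate_xA_pow_mul (Y : Witt F p) (k : ℕ) (a : TruncA F p) :
    truncEval F p ((Y.toLinearMap ^ k) (xA F p ^ k * a)) =
      k.factorial * truncEval F p (Y (xA F p)) ^ k * truncEval F p a := by
  induction k generalizing a with
  | zero => simp
  | succ k ih =>
    have h : Y (xA F p ^ (k + 1) * a) =
        xA F p ^ k * (((k + 1 : ℕ) : TruncA F p) * Y (xA F p) * a + xA F p * Y a) := by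
      rw [Derivation.leibniz, Derivation.leibniz_pow]
      simp only [smul_eq_mul, nsmul_eq_mul, Nat.add_sub_cancel]
      ring
    rw [pow_succ, Module.End.mul_apply, Derivation.coeFn_coe, h, ih]
    simp only [map_add, map_mul, map_natCast, truncEval_xA, zero_mul, add_zero,
      Nat.factorial_succ, Nat.cast_mul]
    ring

theorem exists_apply_eq_one [CharP F p] {D : Witt F p} (hD : D (xA F p) = 1) {Y : Witt F p}
    (hY : Y.toLinearMap ^ p = 0) (h : truncEval F p (Y (xA F p)) ≠ 0) :
    ∃ y, Y y = 1 ∧ truncEval F p y = 0 := by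
  have hp := (Fact.out : p.Prime).two_le
  set u := (Y.toLinearMap ^ (p - 1)) (xA F p ^ (p - 1) * 1) with hu
  have hu0 : truncEval F p u ≠ 0 := by
    rw [hu, truncEval_iterate_xA_pow_mul, map_one, mul_one]
    refine mul_ne_zero (fun h0 => ?_) (pow_ne_zero _ h)
    rw [CharP.cast_eq_zero_iff F p, (Fact.out : p.Prime).dvd_factorial] at h0
    omega
  have hYu : Y u = 0 := by
    have h1 : (Y.toLinearMap ^ (p - 1 + 1)) (xA F p ^ (p - 1) * 1) = 0 := by
      rw [show p - 1 + 1 = p by omega, hY, LinearMap.zero_apply]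
    rw [pow_succ', Module.End.mul_apply] at h1
    exact h1
  obtain ⟨b, hb⟩ : ∃ b, b * Y (xA F p) = 1 := by
    have hnil : IsNilpotent (Y (xA F p) - algebraMap F _ (truncEval F p (Y (xA F p)))) :=
      ⟨p, pow_eq_zero_of_truncEval_eq_zero (truncEval_sub_algebraMap _)⟩
    have hun : IsUnit (algebraMap F (TruncA F p) (truncEval F p (Y (xA F p)))) :=
      (IsUnit.mk0 _ h).map _
    have := hnil.isUnit_add_left_of_commute hun (Commute.all _ _)
    rw [add_sub_cancel] at this
    exact this.exists_left_inv
  have hDu : D u = 0 := by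
    rw [witt_eq_smul hD Y, Derivation.smul_apply, smul_eq_mul] at hYu
    rw [← one_mul (D u), ← hb, mul_assoc, hYu, mul_zero]
  obtain ⟨c, hc⟩ := exists_algebraMap_eq_of_apply_eq_zero hD hDu
  have hc0 : c ≠ 0 := by
    rintro rfl
    exact hu0 (by rw [← hc]; simp)
  set v := (Y.toLinearMap ^ (p - 2)) (xA F p ^ (p - 1) * 1) with hv
  have hYv : Y v = u := by
    rw [hu, show p - 1 = p - 2 + 1 by omega, pow_succ', Module.End.mul_apply,
      show p - 2 + 1 = p - 1 by omega]
    rfl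
  refine ⟨c⁻¹ • v - algebraMap F _ (truncEval F p (c⁻¹ • v)), ?_,
    truncEval_sub_algebraMap _⟩
  rw [map_sub, Derivation.map_algebraMap, sub_zero, Derivation.map_smul, hYv, ← hc,
    Algebra.smul_def, ← map_mul, inv_mul_cancel₀ hc0, map_one]

theorem algHom_injective_of_apply_eq_one [CharP F p] {D Y : Witt F p} (hD : D (xA F p) = 1)
    (φ : TruncA F p →ₐ[F] TruncA F p) (h : Y (φ (xA F p)) = 1) : Function.Injective φ := by
  have key : ∀ n ≤ p, ∀ q : F[X], q.degree < n → φ (AdjoinRoot.mk _ q) = 0 → q = 0 := by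
    intro n
    induction n with
    | zero => intro _ q hq _; simpa using hq
    | succ n ih =>
      intro hn q hq hφ
      have hq0 : derivative q = 0 := by
        by_cases hne : q = 0
        · simp [hne]
        refine ih (by omega) _ ?_ ?_
        · exact (degree_derivative_lt hne).trans_le (Order.le_of_lt_succ hq)
        · rw [← witt_apply_mk hD, ← apply_algHom_eq hD φ h, hφ, map_zero]
      have hC := eq_C_of_derivative_eq_zero_of_degree_lt
        (hq.trans_le (by exact_mod_cast hn)) hq0
      rw [hC, AdjoinRoot.mk_C, ← AdjoinRoot.algebraMap_eq, AlgHom.commutes] at hφ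
      have h0 := congrArg (truncEval F p) hφ
      rw [AlgHom.commutes, map_zero] at h0
      rw [hC, show q.coeff 0 = 0 from h0, C_0]
  rw [injective_iff_map_eq_zero]
  intro a ha
  obtain ⟨q, hq, rfl⟩ := exists_mk_eq_of_degree_lt a
  rw [key p le_rfl q hq ha, map_zero]

theorem exists_lieEquiv_apply_eq [CharP F p] {D : Witt F p} (hD : D (xA F p) = 1) {Y : Witt F p}
    {y : TruncA F p} (hy : Y y = 1) (hy0 : truncEval F p y = 0) :
    ∃ σ : Witt F p ≃ₗ⁅F⁆ Witt F p, σ D = Y := by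
  let φ : TruncA F p →ₐ[F] TruncA F p := AdjoinRoot.liftAlgHom _ (Algebra.ofId F _) y
    (by simpa using pow_eq_zero_of_truncEval_eq_zero hy0)
  have hφ : Y (φ (xA F p)) = 1 := by
    rw [show φ (xA F p) = y from AdjoinRoot.liftAlgHom_root _ _ _ _, hy]
  have hinj := algHom_injective_of_apply_eq_one hD φ hφ
  have : FiniteDimensional F (TruncA F p) := (monic_X_pow p).finite_adjoinRoot
  have hbij : Function.Bijective φ :=
    ⟨hinj, (LinearMap.injective_iff_surjective (f := φ.toLinearMap)).mp hinj⟩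
  refine ⟨Derivation.conjLieEquiv (AlgEquiv.ofBijective φ hbij), ?_⟩
  ext a
  obtain ⟨b, rfl⟩ := (AlgEquiv.ofBijective φ hbij).surjective a
  rw [Derivation.conjLieEquiv_apply, AlgEquiv.symm_apply_apply]
  exact (apply_algHom_eq hD φ hφ b).symm

theorem truncEval_eq_zero_of_apply_xA_eq_xA_mul {D Y : Witt F p}
    (hD : D (xA F p) = 1) (hY : Y.toLinearMap ^ p = 0) {b : TruncA F p}
    (hb : Y (xA F p) = xA F p * b) : truncEval F p b = 0 := by
  have key : ∀ k : ℕ, ∃ h, (Y.toLinearMap ^ k) (xA F p) = xA F p * h ∧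
      truncEval F p h = truncEval F p b ^ k := by
    intro k
    induction k with
    | zero => exact ⟨1, by simp⟩
    | succ k ih =>
      obtain ⟨h, h1, h2⟩ := ih
      refine ⟨b * h + Y h, ?_, ?_⟩
      · rw [pow_succ', Module.End.mul_apply, h1]
        change Y _ = _
        rw [Derivation.leibniz, hb, smul_eq_mul, smul_eq_mul]
        ring
      · rw [witt_eq_smul hD Y, Derivation.smul_apply, hb]
        simp [h2, pow_succ']
  obtain ⟨h, h1, h2⟩ := key p
  rw [hY, LinearMap.zero_apply] at h1
  rw [truncEval_eq_zero_of_xA_mul_eq_zero h1.symm] at h2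
  exact pow_eq_zero_iff (Fact.out : p.Prime).ne_zero |>.mp h2.symm

theorem not_lieEquiv_apply_eq [CharP F p] (hp : 3 < p) {D Y : Witt F p} (hD : D (xA F p) = 1)
    (hY : Y.toLinearMap ^ p = 0) (h : truncEval F p (Y (xA F p)) = 0)
    (σ : Witt F p ≃ₗ⁅F⁆ Witt F p) : σ D ≠ Y := by
  intro hσ
  have hlie : ∀ n, ∀ f : TruncA F p, Y (xA F p) = f →
      ((n + 1 : ℕ) : TruncA F p) * xA F p ^ n * f = 0 → xA F p ^ (n + 1) * D f = 0 →
      ⁅Y, xA F p ^ (n + 1) • D⁆ = 0 := by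
    intro n f hf h1 h2
    apply witt_ext
    rw [Derivation.commutator_apply, Derivation.smul_apply, Derivation.smul_apply, hD, hf]
    simp only [smul_eq_mul, mul_one, Derivation.leibniz_pow, nsmul_eq_mul, Nat.add_sub_cancel,
      Derivation.zero_apply, hf]
    rw [← mul_assoc, h1, h2, sub_zero]
  obtain ⟨b, hb⟩ := exists_eq_xA_mul h
  obtain ⟨c, rfl⟩ :=
    exists_eq_xA_mul (truncEval_eq_zero_of_apply_xA_eq_xA_mul hD hY hb)
  obtain ⟨m, rfl⟩ : ∃ m, p = m + 3 := ⟨p - 3, by omega⟩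
  have hx : xA F (m + 3) ^ (m + 3) = 0 := xA_pow_eq_zero le_rfl
  obtain ⟨r, hr⟩ := exists_eq_smul_of_lie_eq_zero hD σ hσ
    (hlie (m + 1) _ hb (by linear_combination (((m + 1 + 1 : ℕ) : TruncA F (m + 3)) * c) * hx)
      (by
        simp only [Derivation.leibniz, hD, smul_eq_mul, mul_one]
        linear_combination (2 * c + xA F (m + 3) * D c) * hx))
  have hr1 := congrArg (fun T : Witt F (m + 3) => T (xA F (m + 3))) hr
  simp only [Derivation.smul_apply, hD, smul_eq_mul, mul_one] at hr1
  have hr0 : r ≠ 0 := by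
    rintro rfl
    exact xA_pow_ne_zero (by omega) (hr1.trans (zero_smul _ _))
  have hf : Y (xA F (m + 3)) = r⁻¹ • xA F (m + 3) ^ (m + 2) := by
    rw [hr1, smul_smul, inv_mul_cancel₀ hr0, one_smul]
  obtain ⟨k, rfl⟩ : ∃ k, m = k + 1 := ⟨m - 1, by omega⟩
  obtain ⟨s, hs⟩ := exists_eq_smul_of_lie_eq_zero hD σ hσ
    (hlie (k + 1) _ hf
      (by
        rw [mul_smul_comm, mul_assoc, ← pow_add, xA_pow_eq_zero (by omega), mul_zero, smul_zero])
      (by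
        rw [Derivation.map_smul, Derivation.leibniz_pow, hD, mul_smul_comm, mul_smul_comm,
          smul_eq_mul, mul_one, ← pow_add, xA_pow_eq_zero (by omega), smul_zero, smul_zero]))
  have hs1 := congrArg (fun T : Witt F (k + 1 + 3) => xA F (k + 1 + 3) * T (xA F (k + 1 + 3))) hs
  simp only [Derivation.smul_apply, hD, smul_eq_mul, mul_one, hf, mul_smul_comm] at hs1
  rw [← pow_succ', ← pow_succ', xA_pow_eq_zero (n := k + 1 + 2 + 1) (by omega), smul_zero,
    smul_zero] at hs1
  exact xA_pow_ne_zero (by omega) hs1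

end TruncatedPolynomial

/-- A nilpotent element `X` of the Witt algebra (i.e. `Xᵖ = 0` as a linear endomorphism of `A`)
lies outside the span of `{xD, x²D, …, x^{p−1}D}` if and only if it lies in the orbit of `D`
under the automorphism group of `W`. -/
theorem nilpotent_outside_g0_iff_in_orbit_of_D
    (F : Type*) [Field F] [IsAlgClosed F] (p : ℕ) [Fact p.Prime] [CharP F p] (hp : 3 < p)
    (D : Witt F p) (hD : D (xA F p) = 1)
    (Y : Witt F p) (hY : Y.toLinearMap ^ p = 0) :
    Y ∉ Submodule.span F ((fun i : ℕ => xA F p ^ i • D) '' Set.Icc 1 (p - 1)) ↔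
      ∃ σ : Witt F p ≃ₗ⁅F⁆ Witt F p, σ D = Y := by
  rw [mem_span_xA_pow_smul_iff hD]
  constructor
  · intro h
    obtain ⟨y, hy, hy0⟩ := exists_apply_eq_one hD hY h
    exact exists_lieEquiv_apply_eq hD hy hy0
  · rintro ⟨σ, hσ⟩ h
    exact not_lieEquiv_apply_eq hp hD hY h σ hσ
end

section
/- Let k₋₁, k₀, …, k_{p−2} ∈ 𝔽 and X = Σ_{i=−1}^{p−2} kᵢ·x^{i+1}D ∈ W. Then the characteristic polynomial of X, viewed as a linear endomorphism of the p-dimensional 𝔽-vector space A, equals λᵖ + f·λ, where f = det M and M is the (p−1)×(p−1) matrix with rows and columns indexed by 0, …, p−2 whose (i,j) entry is (j+1)·k_{i−j} (with the convention k_m = 0 for m < −1). -/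
open Polynomial

theorem Polynomial.coeff_modByMonic_X_pow {R : Type*} [CommRing R] (f : R[X]) {n i : ℕ}
    (hi : i < n) : (f %ₘ X ^ n).coeff i = f.coeff i := by
  conv_rhs => rw [← modByMonic_add_div f (X ^ n)]
  rw [coeff_add, coeff_X_pow_mul', if_neg (by omega), add_zero]

/-- A monic polynomial over an algebraically closed field with no nonzero root is a power
of `X`. -/
theorem Polynomial.Monic.eq_X_pow_of_forall_isRoot_eq_zero {F : Type*} [Field F] [IsAlgClosed F]
    {P : F[X]} (hP : P.Monic) (h : ∀ μ, P.IsRoot μ → μ = 0) : P = X ^ P.natDegree := by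
  have hs := IsAlgClosed.splits P
  have hr : P.roots = Multiset.replicate P.natDegree 0 :=
    Multiset.eq_replicate.2 ⟨hs.natDegree_eq_card_roots.symm,
      fun μ hμ => h μ (isRoot_of_mem_roots hμ)⟩
  conv_lhs => rw [hs.eq_prod_roots_of_monic hP, hr]
  simp

/-- A monic polynomial of degree `p` in characteristic `p` vanishing on the line `𝔽ₚ μ`, `μ ≠ 0`,
is `Xᵖ - μᵖ⁻¹ X`. -/
theorem Polynomial.Monic.eq_X_pow_sub_of_eval_natCast_mul {F : Type*} [Field F] {p : ℕ}
    [Fact p.Prime] [CharP F p] {P : F[X]} (hP : P.Monic) (hdeg : P.natDegree = p) {μ : F}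
    (hμ : μ ≠ 0) (h : ∀ n : ℕ, P.eval ((n : F) * μ) = 0) :
    P = X ^ p - C (μ ^ (p - 1)) * X := by
  have hp := (Fact.out : p.Prime)
  have hlt : (C (μ ^ (p - 1)) * X : F[X]).degree < p :=
    (degree_C_mul_X_le _).trans_lt (by exact_mod_cast hp.one_lt)
  refine eq_of_degree_sub_lt_of_eval_index_eq (v := fun n : ℕ => (n : F) * μ)
    (Finset.range p) ?_ ?_ ?_
  · intro a ha b hb hab
    have := (CharP.natCast_eq_natCast F p).1 (mul_right_cancel₀ hμ hab)
    rwa [Nat.ModEq, Nat.mod_eq_of_lt (by simpa using ha),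
      Nat.mod_eq_of_lt (by simpa using hb)] at this
  · rw [Finset.card_range, ← sub_add]
    refine (degree_add_le _ _).trans_lt (max_lt ?_ hlt)
    have hPd : P.degree = p := by rw [degree_eq_natDegree hP.ne_zero, hdeg]
    rw [← hPd]
    refine degree_sub_lt_left (by rw [hPd, degree_X_pow]) hP.ne_zero ?_
    rw [hP.leadingCoeff, (monic_X_pow p).leadingCoeff]
  · intro n _
    have hn : (n : F) ^ p = n := by
      rw [← frobenius_def, map_natCast]
    have hμp : μ ^ (p - 1) * μ = μ ^ p := pow_sub_one_mul hp.ne_zero μ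
    rw [h]
    simp only [eval_sub, eval_mul, eval_pow, eval_X, eval_C, mul_pow, hn]
    rw [← hμp]
    ring

theorem Matrix.charpoly_eq_X_mul_of_column_zero {R : Type*} [CommRing R] {q : ℕ}
    (N : Matrix (Fin (q + 1)) (Fin (q + 1)) R) (h : ∀ i, N i 0 = 0) :
    N.charpoly = X * (N.submatrix Fin.succ Fin.succ).charpoly := by
  rw [Matrix.charpoly, Matrix.det_succ_column_zero, Fin.sum_univ_succ, Finset.sum_eq_zero]
  · have : (N.charmatrix.submatrix (Fin.succAbove 0) Fin.succ)
        = (N.submatrix Fin.succ Fin.succ).charmatrix := by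
      ext i j : 2
      simp [Matrix.charmatrix_apply, Matrix.diagonal_apply]
    rw [this]
    simp [h, Matrix.charpoly]
  · intro i _
    simp [h]

/-- The monomial basis `1, x, …, xᵖ⁻¹` of the truncated polynomial algebra. -/
noncomputable def truncBasis (F : Type*) [Field F] (p : ℕ) : Module.Basis (Fin p) F (TruncA F p) :=
  (AdjoinRoot.powerBasis' (monic_X_pow p)).basis.reindex
    (finCongr (by simp))

theorem truncBasis_apply (F : Type*) [Field F] (p : ℕ) (i : Fin p) :
    truncBasis F p i = AdjoinRoot.mk (X ^ p) (X ^ (i : ℕ)) := by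
  rw [truncBasis, Module.Basis.reindex_apply, PowerBasis.coe_basis]
  simp

theorem truncBasis_repr_mk (F : Type*) [Field F] (p : ℕ) (f : F[X]) (i : Fin p) :
    (truncBasis F p).repr (AdjoinRoot.mk (X ^ p) f) i = f.coeff i := by
  rw [truncBasis, Module.Basis.repr_reindex_apply]
  change (AdjoinRoot.modByMonicHom (monic_X_pow p) (AdjoinRoot.mk (X ^ p) f)).coeff i = _
  rw [AdjoinRoot.modByMonicHom_mk, coeff_modByMonic_X_pow f i.2]

theorem Witt.apply_mk {F : Type*} [Field F] {p : ℕ} (Y : Witt F p) {U : F[X]}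
    (hU : Y (xA F p) = AdjoinRoot.mk _ U) (f : F[X]) :
    Y (AdjoinRoot.mk _ f) = AdjoinRoot.mk _ (derivative f * U) := by
  rw [← AdjoinRoot.aeval_eq, Derivation.map_aeval, AdjoinRoot.aeval_eq, map_mul, smul_eq_mul, ← hU]
  rfl

theorem Witt.toMatrix_truncBasis {F : Type*} [Field F] {p : ℕ} (Y : Witt F p) {U : F[X]}
    (hU : Y (xA F p) = AdjoinRoot.mk _ U) (i j : Fin p) :
    LinearMap.toMatrix (truncBasis F p) (truncBasis F p) Y.toLinearMap i j
      = (j : F) * (X ^ (j - 1 : ℕ) * U).coeff i := by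
  rw [LinearMap.toMatrix_apply, truncBasis_apply, Derivation.coeFn_coe, Y.apply_mk hU,
    truncBasis_repr_mk, derivative_X_pow, mul_assoc, coeff_C_mul]

theorem Witt.pow_eigenvector {F : Type*} [Field F] {p : ℕ} (Y : Witt F p) {μ : F} {v : TruncA F p}
    (hv : Y v = μ • v) (n : ℕ) : Y (v ^ n) = ((n : F) * μ) • v ^ n := by
  rw [Derivation.leibniz_pow, hv]
  cases n with
  | zero => simp
  | succ n =>
    rw [add_tsub_cancel_right, smul_eq_mul, mul_smul_comm, ← pow_succ, mul_smul,
      Nat.cast_smul_eq_nsmul]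

/-- If `Yx` is a unit, then every eigenvector of `Y` has nonzero constant term. -/
theorem Witt.coeff_zero_ne_zero_of_eigenvector {F : Type*} [Field F] {p : ℕ} [Fact p.Prime]
    [CharP F p] (Y : Witt F p) {U : F[X]} (hU : Y (xA F p) = AdjoinRoot.mk _ U)
    (hU0 : U.coeff 0 ≠ 0) {μ : F} {f : F[X]}
    (hv : Y (AdjoinRoot.mk _ f) = μ • AdjoinRoot.mk _ f) (hf : AdjoinRoot.mk (X ^ p : F[X]) f ≠ 0) :
    f.coeff 0 ≠ 0 := by
  intro hf0
  have hdvd : X ^ p ∣ derivative f * U - C μ * f := by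
    rw [← AdjoinRoot.mk_eq_mk, ← Y.apply_mk hU, hv, map_mul, Algebra.smul_def]
    rfl
  have key : ∀ m, m < p → X ^ (m + 1) ∣ f := by
    intro m
    induction m with
    | zero => intro _; simpa [X_dvd_iff] using hf0
    | succ m ih =>
      intro hm
      obtain ⟨g, rfl⟩ := ih (by omega)
      have h1 : X ^ (m + 1) ∣
          derivative (X ^ (m + 1) * g) * U - C μ * (X ^ (m + 1) * g) :=
        (pow_dvd_pow X hm.le).trans hdvd
      have h2 : (X : F[X]) ^ m * X ∣ X ^ m * (C ((m + 1 : ℕ) : F) * (g * U)) := by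
        have h3 := h1.add (Dvd.intro (C μ * g - derivative g * U) rfl)
        rw [derivative_mul, derivative_X_pow, add_tsub_cancel_right] at h3
        rw [← pow_succ]
        convert h3 using 1
        ring
      rw [mul_dvd_mul_iff_left (pow_ne_zero _ X_ne_zero), X_dvd_iff, coeff_C_mul,
        mul_coeff_zero] at h2
      have hm0 : ((m + 1 : ℕ) : F) ≠ 0 := by
        rw [Ne, CharP.cast_eq_zero_iff F p]
        exact Nat.not_dvd_of_pos_of_lt (by omega) hm
      have hg : g.coeff 0 = 0 := by simpa only [mul_eq_zero, hm0, hU0, false_or, or_false] using h2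
      rw [pow_succ _ (m + 1)]
      exact mul_dvd_mul_left _ (X_dvd_iff.2 hg)
  have hp := (Fact.out : p.Prime).pos
  refine hf (AdjoinRoot.mk_eq_zero.2 ?_)
  simpa [Nat.sub_add_cancel hp] using key (p - 1) (by omega)

theorem TruncA.mk_pow_ne_zero {F : Type*} [Field F] {p : ℕ} (hp : p ≠ 0) {f : F[X]}
    (hf : f.coeff 0 ≠ 0) (n : ℕ) : AdjoinRoot.mk (X ^ p : F[X]) f ^ n ≠ 0 := by
  rw [← map_pow, Ne, AdjoinRoot.mk_eq_zero]
  intro h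
  exact hf (X_dvd_iff.1 (prime_X.dvd_of_dvd_pow ((dvd_pow_self X hp).trans h)))

/-- The charpoly of an element of the Witt algebra has the form `Xᵖ + c X`. -/
theorem Witt.exists_charpoly_eq {F : Type*} [Field F] [IsAlgClosed F] {p : ℕ} [Fact p.Prime]
    [CharP F p] [Module.Finite F (TruncA F p)] (Y : Witt F p) :
    ∃ c : F, LinearMap.charpoly Y.toLinearMap = X ^ p + C c * X := by
  have hp := (Fact.out : p.Prime)
  obtain ⟨U, hU⟩ := AdjoinRoot.mk_surjective (Y (xA F p))
  have hdeg : (LinearMap.charpoly Y.toLinearMap).natDegree = p := by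
    rw [LinearMap.charpoly_natDegree, Module.finrank_eq_card_basis (truncBasis F p),
      Fintype.card_fin]
  have hmonic := LinearMap.charpoly_monic Y.toLinearMap
  by_cases hroot : ∀ μ, (LinearMap.charpoly Y.toLinearMap).IsRoot μ → μ = 0
  · exact ⟨0, by simpa [hdeg] using hmonic.eq_X_pow_of_forall_isRoot_eq_zero hroot⟩
  push Not at hroot
  obtain ⟨μ, hμ, hμ0⟩ := hroot
  suffices ∃ ν : F, ν ≠ 0 ∧
      ∀ n : ℕ, (LinearMap.charpoly Y.toLinearMap).eval ((n : F) * ν) = 0 by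
    obtain ⟨ν, hν, h⟩ := this
    refine ⟨-ν ^ (p - 1), ?_⟩
    rw [hmonic.eq_X_pow_sub_of_eval_natCast_mul hdeg hν h, C_neg, neg_mul, sub_eq_add_neg]
  by_cases hU0 : U.coeff 0 = 0
  · obtain ⟨V, rfl⟩ := X_dvd_iff.2 hU0
    have hchar : LinearMap.charpoly Y.toLinearMap
        = ∏ j : Fin p, (X - C ((j : F) * V.coeff 0)) := by
      have hN := Y.toMatrix_truncBasis hU.symm
      have hX (j : Fin p) (hj : (j : ℕ) ≠ 0) : X ^ (j - 1 : ℕ) * (X * V) = X ^ (j : ℕ) * V := by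
        rw [← mul_assoc, pow_sub_one_mul hj]
      rw [← LinearMap.charpoly_toMatrix _ (truncBasis F p), ← Matrix.charpoly_transpose,
        Matrix.charpoly_of_isUpperTriangular]
      · refine Finset.prod_congr rfl fun j _ => ?_
        rw [Matrix.transpose_apply, hN]
        by_cases hj : (j : ℕ) = 0
        · simp [hj]
        · rw [hX j hj, coeff_X_pow_mul', if_pos le_rfl, Nat.sub_self]
      · intro i j hij
        rw [Matrix.transpose_apply, hN, hX i (by have : j < i := hij; omega), coeff_X_pow_mul',
          if_neg (by simpa using hij), mul_zero]
    refine ⟨V.coeff 0, ?_, fun n => ?_⟩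
    · intro hV
      rw [hchar, hV] at hμ
      simp [IsRoot, hμ0] at hμ
    · rw [hchar, eval_prod]
      refine Finset.prod_eq_zero (Finset.mem_univ ⟨n % p, Nat.mod_lt _ hp.pos⟩) ?_
      simp [CharP.cast_eq_mod F p n]
  · rw [← Module.End.hasEigenvalue_iff_isRoot_charpoly] at hμ
    obtain ⟨v, hv⟩ := hμ.exists_hasEigenvector
    obtain ⟨f, rfl⟩ := AdjoinRoot.mk_surjective v
    have hf := Y.coeff_zero_ne_zero_of_eigenvector hU.symm hU0 hv.apply_eq_smul hv.2
    refine ⟨μ, hμ0, fun n => ?_⟩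
    change IsRoot _ _
    rw [← Module.End.hasEigenvalue_iff_isRoot_charpoly]
    exact Module.End.hasEigenvalue_of_hasEigenvector (Module.End.hasEigenvector_iff.2
      ⟨Module.End.mem_eigenspace_iff.2 (Y.pow_eigenvector hv.apply_eq_smul n),
        TruncA.mk_pow_ne_zero hp.ne_zero hf n⟩)

/-- For `X = ∑_{i=−1}^{p−2} kᵢ x^{i+1}D`, the characteristic polynomial of `X` as a linear
endomorphism of the `p`-dimensional vector space `A` equals `λᵖ + f·λ`, where `f = det M` and
`M` is the `(p−1)×(p−1)` matrix with `(i,j)`-entry `(j+1)·k_{i−j}` (with `k_m = 0` for `m < −1`). -/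
theorem charpoly_of_witt_element
    (F : Type*) [Field F] [IsAlgClosed F] (p : ℕ) [Fact p.Prime] [CharP F p] (hp : 3 < p)
    [Module.Finite F (TruncA F p)]
    (D : Witt F p) (hD : D (xA F p) = 1)
    (k : ℤ → F) (hk : ∀ m : ℤ, m < -1 → k m = 0)
    (Y : Witt F p)
    (hY : Y = ∑ i ∈ Finset.Icc (-1 : ℤ) ((p : ℤ) - 2), k i • (xA F p ^ (i + 1).toNat • D))
    (M : Matrix (Fin (p - 1)) (Fin (p - 1)) F)
    (hM : ∀ i j : Fin (p - 1), M i j = ((j : ℕ) + 1 : F) * k (((i : ℕ) : ℤ) - ((j : ℕ) : ℤ))) :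
    LinearMap.charpoly Y.toLinearMap = X ^ p + C M.det * X := by
  obtain ⟨q, rfl⟩ : ∃ q, p = q + 1 := ⟨p - 1, by omega⟩
  set U : F[X] := ∑ j ∈ Finset.range (q + 1), C (k ((j : ℤ) - 1)) * X ^ j with hUdef
  have hUcoeff (m : ℕ) (hm : m < q + 1) : U.coeff m = k ((m : ℤ) - 1) := by
    simp only [hUdef, finsetSum_coeff, coeff_C_mul_X_pow]
    rw [Finset.sum_ite_eq, if_pos (Finset.mem_range.2 hm)]
  have hU : Y (xA F (q + 1)) = AdjoinRoot.mk _ U := by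
    rw [hY, hUdef, map_sum, ← Derivation.coeFnAddMonoidHom_apply, map_sum, Finset.sum_apply]
    refine Finset.sum_bij' (fun i _ => (i + 1).toNat) (fun j _ => (j : ℤ) - 1) ?_ ?_ ?_ ?_ ?_
    · intro i hi
      simp only [Finset.mem_Icc, Finset.mem_range] at hi ⊢
      omega
    · intro j hj
      simp only [Finset.mem_Icc, Finset.mem_range] at hj ⊢
      omega
    · intro i hi
      simp only [Finset.mem_Icc] at hi
      omega
    · intro j _
      omega
    · intro i hi
      simp only [Finset.mem_Icc] at hi
      rw [Int.toNat_of_nonneg (by omega), add_sub_cancel_right,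
        Derivation.coeFnAddMonoidHom_apply, Derivation.smul_apply,
        Derivation.smul_apply, hD, smul_eq_mul, mul_one, map_mul, map_pow, AdjoinRoot.mk_X,
        Algebra.smul_def]
      rfl
  obtain ⟨c, hc⟩ := Y.exists_charpoly_eq
  have hN := Y.toMatrix_truncBasis hU
  have hsub : (LinearMap.toMatrix (truncBasis F (q + 1)) (truncBasis F (q + 1))
      Y.toLinearMap).submatrix Fin.succ Fin.succ = M := by
    ext i j
    have hi : (i : ℕ) < q := i.2
    rw [Matrix.submatrix_apply, hN, hM, Fin.val_succ, Fin.val_succ, add_tsub_cancel_right,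
      coeff_X_pow_mul', Nat.cast_add, Nat.cast_one]
    congr 1
    split_ifs with hij
    · rw [hUcoeff _ (by omega)]
      congr 1
      omega
    · rw [hk _ (by omega)]
  have hcp : LinearMap.charpoly Y.toLinearMap = X * M.charpoly := by
    rw [← LinearMap.charpoly_toMatrix _ (truncBasis F (q + 1)),
      Matrix.charpoly_eq_X_mul_of_column_zero _ (fun i => by rw [hN]; simp), hsub]
  have heven : Even q := by
    have := (Fact.out : (q + 1).Prime).even_sub_one (by omega)
    simpa using this
  have hdet : M.det = c := by
    have h0 := congrArg (fun P : F[X] => P.coeff 1) (hcp.symm.trans hc)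
    have hq : q ≠ 0 := by omega
    have hq' : Even (q + 1 - 1) := heven
    rw [Matrix.det_eq_sign_charpoly_coeff, Fintype.card_fin, hq'.neg_one_pow, one_mul]
    simpa [coeff_X_pow, hq, coeff_X_mul] using h0
  rw [hc, hdet]
end

section
/- Let X = D + Σ_{i=0}^{p−2} kᵢ·x^{i+1}D and Y = xD + Σ_{i=1}^{p−2} lᵢ·x^{i+1}D be elements of W (kᵢ, lᵢ ∈ 𝔽) satisfying [X, Y] = X. Then Xᵖ = 0 as a linear endomorphism of A. -/
open Polynomial

/-- In characteristic `p`, the `p`-th power of `b ↦ ab - ba` is `b ↦ aᵖb - baᵖ`. -/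
theorem mulLeft_sub_mulRight_pow_char_apply {F B : Type*} [Field F] [Ring B] [Algebra F B]
    [Nontrivial B] (p : ℕ) [Fact p.Prime] [CharP F p] (a b : B) :
    ((LinearMap.mulLeft F a - LinearMap.mulRight F a) ^ p) b = a ^ p * b - b * a ^ p := by
  have : CharP (Module.End F B) p :=
    charP_of_injective_algebraMap (algebraMap F (Module.End F B)).injective p
  have hcomm : Commute (LinearMap.mulLeft F a) (LinearMap.mulRight F a) := by
    ext; simp [mul_assoc]
  rw [sub_pow_char_of_commute p hcomm, LinearMap.pow_mulLeft, LinearMap.pow_mulRight]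
  simp

/-- Iterating the commutator with `d` on a multiplication operator, for a derivation `d`. -/
theorem commutator_derivation_pow_mulLeft {F A : Type*} [Field F] [CommRing A] [Algebra F A]
    (d : Derivation F A A) (a : A) (n : ℕ) :
    ((LinearMap.mulLeft F d.toLinearMap - LinearMap.mulRight F d.toLinearMap) ^ n)
      (LinearMap.mulLeft F a) =
      LinearMap.mulLeft F ((d.toLinearMap ^ n) a) := by
  induction n with
  | zero => simp
  | succ n ih =>
    rw [pow_succ', pow_succ', Module.End.mul_apply, ih]
    ext b
    simp [mul_comm]

/-- In characteristic `p`, the `p`-th power of a derivation is a derivation. -/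
noncomputable def Derivation.powChar {F A : Type*} [Field F] [CommRing A] [Algebra F A]
    [Nontrivial A] (p : ℕ) [Fact p.Prime] [CharP F p] (d : Derivation F A A) :
    Derivation F A A :=
  Derivation.mk' (d.toLinearMap ^ p) fun a b => by
    have h := LinearMap.congr_fun ((mulLeft_sub_mulRight_pow_char_apply (F := F) p d.toLinearMap
      (LinearMap.mulLeft F a)).symm.trans (commutator_derivation_pow_mulLeft d a p)) b
    simp only [LinearMap.sub_apply, Module.End.mul_apply, LinearMap.mulLeft_apply] at h
    rw [smul_eq_mul, smul_eq_mul, mul_comm b, ← h]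
    ring

/-- A derivation of the truncated polynomial algebra is a multiple of `D = d/dx`. -/
theorem TruncA.derivation_apply {F : Type*} [Field F] {p : ℕ} {D : Witt F p}
    (hD : D (xA F p) = 1) (E : Witt F p) (a : TruncA F p) :
    E a = E (xA F p) * D a := by
  obtain ⟨q, rfl⟩ := AdjoinRoot.mk_surjective a
  rw [← AdjoinRoot.aeval_eq]
  change E (aeval (xA F p) q) = E (xA F p) * D (aeval (xA F p) q)
  simp [Derivation.map_aeval, hD, mul_comm]

/-- The kernel of `D = d/dx` on the truncated polynomial algebra consists of the constants. -/
theorem TruncA.exists_algebraMap_of_derivation_eq_zero {F : Type*} [Field F] {p : ℕ}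
    [Fact p.Prime] [CharP F p] {D : Witt F p} (hD : D (xA F p) = 1) {a : TruncA F p}
    (ha : D a = 0) : ∃ c : F, a = algebraMap F _ c := by
  obtain ⟨q, rfl⟩ := AdjoinRoot.mk_surjective a
  rw [← AdjoinRoot.aeval_eq] at ha
  change D (aeval (xA F p) q) = 0 at ha
  rw [Derivation.map_aeval, hD, smul_eq_mul, mul_one, xA, AdjoinRoot.aeval_eq,
    AdjoinRoot.mk_eq_zero, X_pow_dvd_iff] at ha
  refine ⟨q.coeff 0, ?_⟩
  rw [AdjoinRoot.algebraMap_eq, ← AdjoinRoot.mk_C, AdjoinRoot.mk_eq_mk, X_pow_dvd_iff]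
  rintro (_ | n) hn
  · simp
  · have h := ha n (Nat.lt_of_succ_lt hn)
    rw [coeff_derivative] at h
    have hn0 : (n + 1 : F) ≠ 0 := by
      exact_mod_cast (CharP.cast_eq_zero_iff F p (n + 1)).not.mpr
        (Nat.not_dvd_of_pos_of_lt n.succ_pos hn)
    simpa [coeff_C] using (mul_eq_zero.mp h).resolve_right hn0

/-- If a derivation `d` of the truncated polynomial algebra has `d x` invertible and satisfies
`[d, e] = d` for some derivation `e`, then `dᵖ = 0`. -/
theorem TruncA.pow_char_eq_zero_of_bracket_eq_self {F : Type*} [Field F] {p : ℕ}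
    [Fact p.Prime] [CharP F p] {D d e : Witt F p} (hD : D (xA F p) = 1)
    (hd : IsUnit (d (xA F p))) (hde : ⁅d, e⁆ = d) : d.toLinearMap ^ p = 0 := by
  have hp : p.Prime := Fact.out
  have : Nontrivial (TruncA F p) := AdjoinRoot.nontrivial _ (by simp [hp.ne_zero])
  obtain ⟨u, hu⟩ := hd
  have hE : ∀ a, (d.toLinearMap ^ p) a = d.powChar p a := fun _ => rfl
  have hf : ∀ a, d.powChar p a = (d.powChar p (xA F p) * ↑u⁻¹) * d a := fun a => by
    rw [derivation_apply hD (d.powChar p) a, derivation_apply hD d a, ← hu, mul_assoc,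
      Units.inv_mul_cancel_left]
  have hcomm : d (d.powChar p (xA F p)) = d.powChar p (d (xA F p)) := by
    rw [← hE, ← hE]
    exact LinearMap.congr_fun (Commute.self_pow d.toLinearMap p).eq (xA F p)
  have hdf : D (d.powChar p (xA F p) * ↑u⁻¹) = 0 := by
    generalize hfdef : d.powChar p (xA F p) * ↑u⁻¹ = f at hf
    rw [hf (xA F p), hf (d (xA F p)), Derivation.leibniz, smul_eq_mul, smul_eq_mul,
      add_eq_left, derivation_apply hD d f, ← hu] at hcomm
    simpa using hcomm
  obtain ⟨c, hc⟩ := exists_algebraMap_of_derivation_eq_zero hD hdf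
  have hEc : d.toLinearMap ^ p = c • d.toLinearMap := by
    ext a
    rw [hE, hf, hc, ← Algebra.smul_def]
    rfl
  have hbr : d.toLinearMap * e.toLinearMap - e.toLinearMap * d.toLinearMap =
      d.toLinearMap :=
    congrArg Derivation.toLinearMap hde
  have had : ((LinearMap.mulLeft F d.toLinearMap - LinearMap.mulRight F d.toLinearMap) ^ p)
      e.toLinearMap = 0 := by
    obtain ⟨m, rfl⟩ := Nat.exists_eq_add_of_le' hp.two_le
    simp [pow_succ, hbr]
  rw [mulLeft_sub_mulRight_pow_char_apply, hEc, smul_mul_assoc, mul_smul_comm] at had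
  rw [hEc]
  nth_rewrite 1 [← hbr]
  exact (smul_sub _ _ _).trans had

/-- If `X = D + ∑_{i=0}^{p−2} kᵢ x^{i+1}D` and `Y = xD + ∑_{i=1}^{p−2} lᵢ x^{i+1}D` satisfy
`[X, Y] = X`, then `Xᵖ = 0` as a linear endomorphism of `A`. -/
theorem bracket_eq_self_implies_nilpotent
    (F : Type*) [Field F] [IsAlgClosed F] (p : ℕ) [Fact p.Prime] [CharP F p] (hp : 3 < p)
    (D : Witt F p) (hD : D (xA F p) = 1)
    (k l : ℕ → F) (Xe Ye : Witt F p)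
    (hX : Xe = D + ∑ i ∈ Finset.range (p - 1), k i • (xA F p ^ (i + 1) • D))
    (hYe : Ye = xA F p • D + ∑ i ∈ Finset.Icc 1 (p - 2), l i • (xA F p ^ (i + 1) • D))
    (hbr : ⁅Xe, Ye⁆ = Xe) :
    Xe.toLinearMap ^ p = 0 := by
  refine TruncA.pow_char_eq_zero_of_bracket_eq_self hD ?_ hbr
  have hx : IsNilpotent (xA F p) := ⟨p, by
    rw [xA, ← AdjoinRoot.mk_X, ← map_pow, AdjoinRoot.mk_self]⟩
  have hval : Xe (xA F p) =
      1 + xA F p * ∑ i ∈ Finset.range (p - 1), k i • xA F p ^ i := by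
    have hsum (v : ℕ → Witt F p) : (∑ i ∈ Finset.range (p - 1), v i) (xA F p) =
        ∑ i ∈ Finset.range (p - 1), v i (xA F p) :=
      map_sum ((Pi.evalAddMonoidHom _ (xA F p)).comp Derivation.coeFnAddMonoidHom) v _
    simp [hX, hD, Finset.mul_sum, pow_succ', hsum]
  rw [hval]
  exact ((Commute.all _ _).isNilpotent_mul_right hx).isUnit_one_add
end
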